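/- For every ζ in the open unit disk D and every z in the closed unit disk with z ≠ ζ, Δ_z Γ₁(z,ζ) = (1−|z|²)(G(z,ζ) + H₁(z,ζ)), where Δ_z = ∂²/∂z∂z̄ is the normalized Laplacian acting in the z variable. -/

import Mathlib

open Complex MeasureTheory Metric Set ComplexConjugate
noncomputable section

/-- The Green function `G(z,ζ) = log |(z-ζ)/(1-ζ̄z)|²` for the Laplacian on the unit disk. -/
def greenG (z ζ : ℂ) : ℝ := Real.log (normSq ((z - ζ) / (1 - conj ζ * z)))

/-- The normalized Laplacian `Δ = ∂²/∂z∂z̄ = (1/4)(∂²/∂x² + ∂²/∂y²)`. -/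
def lap (u : ℂ → ℝ) (z : ℂ) : ℝ :=
  (1/4) * (fderiv ℝ (fun w => fderiv ℝ u w 1) z 1
    + fderiv ℝ (fun w => fderiv ℝ u w Complex.I) z Complex.I)

/-- The harmonic compensator `H₁(z,ζ)`. -/
def H1 (z ζ : ℂ) : ℝ :=
  (1 - normSq ζ) *
    ((1/2) * (3 - normSq ζ) * (1 - normSq (z * ζ)) / normSq (1 - z * conj ζ)
      + (1 - normSq ζ) * (z * conj ζ / (1 - z * conj ζ) ^ 2).re)

/-- The Green function `Γ₁(z,ζ)` for the weighted biharmonic operator `Δ(1-|z|²)⁻¹Δ`. -/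
def Γ1 (z ζ : ℂ) : ℝ :=
  (normSq (z - ζ) - (1/4) * normSq (z ^ 2 - ζ ^ 2)) * greenG z ζ
    + (1/8) * (1 - normSq z) * (1 - normSq ζ) *
      (7 - normSq z - normSq ζ - normSq (z * ζ) - 4 * (z * conj ζ).re
        - 2 * (1 - normSq z) * (1 - normSq ζ) * (1 - normSq (z * ζ)) / normSq (1 - z * conj ζ))

/-- `f` is real differentiable at `z` with Wirtinger derivatives `∂f/∂z = a` and `∂f/∂z̄ = b`. -/
def HasWirtingerDerivAt (f : ℂ → ℂ) (a b z : ℂ) : Prop :=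
  HasFDerivAt f (a • ContinuousLinearMap.id ℝ ℂ + b • (conjCLE : ℂ →L[ℝ] ℂ)) z

namespace HasWirtingerDerivAt

variable {f g : ℂ → ℂ} {a b a' b' z : ℂ}

theorem of_hasFDerivAt {L : ℂ →L[ℝ] ℂ} (hf : HasFDerivAt f L z)
    (h : ∀ v, L v = a * v + b * conj v) : HasWirtingerDerivAt f a b z := by
  refine hf.congr_fderiv ?_
  ext1 v
  simp [h]

theorem congr_deriv (hf : HasWirtingerDerivAt f a b z) (ha : a = a') (hb : b = b') :
    HasWirtingerDerivAt f a' b' z := ha ▸ hb ▸ hf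

theorem const (c z : ℂ) : HasWirtingerDerivAt (fun _ => c) 0 0 z :=
  of_hasFDerivAt (hasFDerivAt_const c z) (by simp)

theorem id (z : ℂ) : HasWirtingerDerivAt (fun w => w) 1 0 z :=
  of_hasFDerivAt (hasFDerivAt_id z) (by simp)

theorem star (z : ℂ) : HasWirtingerDerivAt (fun w => conj w) 0 1 z :=
  of_hasFDerivAt (conjCLE : ℂ →L[ℝ] ℂ).hasFDerivAt (by simp)

theorem add (hf : HasWirtingerDerivAt f a b z) (hg : HasWirtingerDerivAt g a' b' z) :
    HasWirtingerDerivAt (fun w => f w + g w) (a + a') (b + b') z :=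
  of_hasFDerivAt (HasFDerivAt.add hf hg) fun v => by simp; ring

theorem sub (hf : HasWirtingerDerivAt f a b z) (hg : HasWirtingerDerivAt g a' b' z) :
    HasWirtingerDerivAt (fun w => f w - g w) (a - a') (b - b') z :=
  of_hasFDerivAt (HasFDerivAt.sub hf hg) fun v => by simp; ring

theorem mul (hf : HasWirtingerDerivAt f a b z) (hg : HasWirtingerDerivAt g a' b' z) :
    HasWirtingerDerivAt (fun w => f w * g w) (a * g z + f z * a') (b * g z + f z * b') z :=
  of_hasFDerivAt (HasFDerivAt.mul hf hg) fun v => by simp; ring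

theorem inv (hf : HasWirtingerDerivAt f a b z) (h : f z ≠ 0) :
    HasWirtingerDerivAt (fun w => (f w)⁻¹) (-a / f z ^ 2) (-b / f z ^ 2) z :=
  of_hasFDerivAt (((hasDerivAt_inv h).hasFDerivAt.restrictScalars ℝ).comp z hf)
    fun v => by simp; ring

theorem re {u : ℂ → ℝ} (hu : HasWirtingerDerivAt (fun w => (u w : ℂ)) a b z) :
    HasFDerivAt u
      (reCLM.comp (a • ContinuousLinearMap.id ℝ ℂ + b • (conjCLE : ℂ →L[ℝ] ℂ))) z :=
  reCLM.hasFDerivAt.comp z hu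

theorem eq_conj {u : ℂ → ℝ} (hu : HasWirtingerDerivAt (fun w => (u w : ℂ)) a b z) :
    b = conj a := by
  have h := HasFDerivAt.unique hu (ofRealCLM.hasFDerivAt.comp z hu.re)
  have h1 := DFunLike.congr_fun h 1
  have h2 := DFunLike.congr_fun h I
  simp [Complex.ext_iff] at h1 h2
  apply Complex.ext <;> simp <;> linarith

theorem log {u : ℂ → ℝ} (hu : HasWirtingerDerivAt (fun w => (u w : ℂ)) a b z) (h : u z ≠ 0) :
    HasWirtingerDerivAt (fun w => (Real.log (u w) : ℂ)) (a / u z) (b / u z) z := by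
  refine of_hasFDerivAt (ofRealCLM.hasFDerivAt.comp z (hu.re.log h)) fun v => ?_
  have hr : ((a * v + b * conj v).re : ℂ) = a * v + b * conj v := by
    rw [hu.eq_conj, ← map_mul, Complex.add_conj]
    simp
  simp only [ContinuousLinearMap.comp_apply, add_apply,
    smul_apply, ofRealCLM_apply, reCLM_apply, smul_eq_mul,
    ContinuousLinearMap.id_apply, ContinuousLinearEquiv.coe_coe, conjCLE_apply, ofReal_mul,
    ofReal_inv, hr]
  ring

theorem log_normSq (hf : HasWirtingerDerivAt f a 0 z) (h : f z ≠ 0) :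
    HasWirtingerDerivAt (fun w => (Real.log (normSq (f w)) : ℂ))
      (a / f z) (conj a / conj (f z)) z := by
  have hc : HasWirtingerDerivAt (fun w => conj (f w)) 0 (conj a) z :=
    of_hasFDerivAt ((conjCLE : ℂ →L[ℝ] ℂ).hasFDerivAt.comp z hf) (by simp)
  have hn := hf.mul hc
  simp only [mul_conj] at hn
  refine (hn.log (by simpa using h)).congr_deriv ?_ ?_ <;>
    · have : conj (f z) ≠ 0 := by simpa using h
      rw [← mul_conj]
      field_simp
      simp

end HasWirtingerDerivAt

theorem lap_eq_re {u : ℂ → ℝ} {A B : ℂ → ℂ} {a b z : ℂ}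
    (hu : ∀ᶠ w in nhds z, HasWirtingerDerivAt (fun w => (u w : ℂ)) (A w) (B w) w)
    (hA : HasWirtingerDerivAt A a b z) : lap u z = b.re := by
  have h1 : (fun w => fderiv ℝ u w 1) =ᶠ[nhds z] fun w => 2 * (A w).re := by
    filter_upwards [hu] with w hw
    rw [hw.re.fderiv]
    simp [hw.eq_conj]; ring
  have h2 : (fun w => fderiv ℝ u w I) =ᶠ[nhds z] fun w => -2 * (A w).im := by
    filter_upwards [hu] with w hw
    rw [hw.re.fderiv]
    simp [hw.eq_conj]; ring
  have d1 := (reCLM.hasFDerivAt.comp z hA).const_mul 2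
  have d2 := (imCLM.hasFDerivAt.comp z hA).const_mul (-2)
  have e1 := (d1.congr_of_eventuallyEq h1).fderiv
  have e2 := (d2.congr_of_eventuallyEq h2).fderiv
  rw [lap, e1, e2]
  simp; ring

/-- The derivative `∂Γ₁(w,ζ)/∂w`. -/
def dΓ1 (w ζ : ℂ) : ℂ :=
  ((conj w - conj ζ) - (1/2) * w * (conj w * conj w - conj ζ * conj ζ)) * (greenG w ζ : ℂ)
    + (conj w - conj ζ) * (1 - (1/4) * (w + ζ) * (conj w + conj ζ)) * (1 - ζ * conj ζ)
      * (1 - w * conj ζ)⁻¹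
    + (1/8) * (1 - ζ * conj ζ) * ((1 - w * conj w) * (0 - conj w - conj w * ζ * conj ζ - 2 * conj ζ)
      - conj w * (7 - w * conj w - ζ * conj ζ - w * conj w * (ζ * conj ζ)
        - 2 * (w * conj ζ + conj w * ζ)))
    - (1/4) * ((1 - ζ * conj ζ) * (1 - ζ * conj ζ)) * (1 - w * conj ζ)⁻¹ * (1 - conj w * ζ)⁻¹ *
      ((1 - w * conj w) * (1 - w * conj w) * (1 - w * conj w * (ζ * conj ζ)) * conj ζ
          * (1 - w * conj ζ)⁻¹
        - (1 - w * conj w) * (1 - w * conj w) * conj w * ζ * conj ζ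
        - 2 * conj w * (1 - w * conj w) * (1 - w * conj w * (ζ * conj ζ)))

theorem ofReal_Γ1 (w ζ : ℂ) : (Γ1 w ζ : ℂ) =
    ((w - ζ) * (conj w - conj ζ)
        - (1/4) * ((w * w - ζ * ζ) * (conj w * conj w - conj ζ * conj ζ))) * (greenG w ζ : ℂ)
      + (1/8) * (1 - ζ * conj ζ) * ((1 - w * conj w) *
        (7 - w * conj w - ζ * conj ζ - w * conj w * (ζ * conj ζ) - 2 * (w * conj ζ + conj w * ζ)))
      - (1/4) * ((1 - ζ * conj ζ) * (1 - ζ * conj ζ)) *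
        ((1 - w * conj w) * (1 - w * conj w) * (1 - w * conj w * (ζ * conj ζ))
          * ((1 - w * conj ζ)⁻¹ * (1 - conj w * ζ)⁻¹)) := by
  rw [Γ1]
  push_cast [re_eq_add_conj, ← mul_conj]
  simp only [map_mul, map_sub, map_pow, map_one, conj_conj, div_eq_mul_inv, mul_inv]
  ring

theorem ofReal_H1 (w ζ : ℂ) : (H1 w ζ : ℂ) =
    (1 - ζ * conj ζ) *
      ((1/2) * (3 - ζ * conj ζ) * (1 - w * conj w * (ζ * conj ζ))
          * ((1 - w * conj ζ)⁻¹ * (1 - conj w * ζ)⁻¹)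
        + (1 - ζ * conj ζ) * (1/2) *
          (w * conj ζ * (1 - w * conj ζ)⁻¹ ^ 2 + conj w * ζ * (1 - conj w * ζ)⁻¹ ^ 2)) := by
  rw [H1]
  push_cast [re_eq_add_conj, ← mul_conj]
  simp only [map_mul, map_sub, map_pow, map_one, map_inv₀, conj_conj, div_eq_mul_inv, inv_pow, mul_inv]
  ring

theorem HasWirtingerDerivAt.greenG {w ζ : ℂ} (h₁ : w - ζ ≠ 0) (h₂ : 1 - w * conj ζ ≠ 0) :
    HasWirtingerDerivAt (fun v => (greenG v ζ : ℂ))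
      ((1 - ζ * conj ζ) * (w - ζ)⁻¹ * (1 - w * conj ζ)⁻¹)
      ((1 - ζ * conj ζ) * (conj w - conj ζ)⁻¹ * (1 - conj w * ζ)⁻¹) w := by
  have h₂' : 1 - conj ζ * w ≠ 0 := by rwa [mul_comm]
  have c₁ : conj w - conj ζ ≠ 0 := by simpa only [map_sub] using (map_ne_zero conj).2 h₁
  have c₂ : 1 - conj w * ζ ≠ 0 := by simpa using (map_ne_zero conj).2 h₂
  have hg : HasWirtingerDerivAt (fun v => (v - ζ) * (1 - conj ζ * v)⁻¹)
      ((1 - ζ * conj ζ) * (1 - w * conj ζ)⁻¹ ^ 2) 0 w := by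
    refine (((HasWirtingerDerivAt.id w).sub (.const ζ w)).mul
      (((HasWirtingerDerivAt.const 1 w).sub
        ((HasWirtingerDerivAt.const (conj ζ) w).mul (.id w))).inv h₂')).congr_deriv ?_ ?_
    · rw [mul_comm w]
      field_simp
      ring
    · simp
  refine (hg.log_normSq (mul_ne_zero h₁ (inv_ne_zero h₂'))).congr_deriv ?_ ?_
  · rw [mul_comm w] at h₂ ⊢
    field_simp
  · simp only [map_mul, map_sub, map_pow, map_inv₀, map_one, conj_conj]
    rw [mul_comm ζ (conj w)]
    field_simp

theorem hasWirtingerDerivAt_Γ1 {w ζ : ℂ} (h₁ : w - ζ ≠ 0) (h₂ : 1 - w * conj ζ ≠ 0) :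
    HasWirtingerDerivAt (fun v => (Γ1 v ζ : ℂ)) (dΓ1 w ζ) (conj (dΓ1 w ζ)) w := by
  have c₂ : 1 - conj w * ζ ≠ 0 := by simpa using (map_ne_zero conj).2 h₂
  have k (c : ℂ) := HasWirtingerDerivAt.const c w
  have i := HasWirtingerDerivAt.id w
  have s := HasWirtingerDerivAt.star w
  have n := i.mul s
  have m := (k 1).sub n
  have q := (((i.sub (k ζ)).mul (s.sub (k (conj ζ)))).sub ((k (1/4)).mul
    (((i.mul i).sub (k (ζ * ζ))).mul ((s.mul s).sub (k (conj ζ * conj ζ)))))).mul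
    (HasWirtingerDerivAt.greenG h₁ h₂)
  have r := (k ((1/8) * (1 - ζ * conj ζ))).mul (m.mul
    (((((k 7).sub n).sub (k (ζ * conj ζ))).sub (n.mul (k (ζ * conj ζ)))).sub
      ((k 2).mul ((i.mul (k (conj ζ))).add (s.mul (k ζ))))))
  have t := (k ((1/4) * ((1 - ζ * conj ζ) * (1 - ζ * conj ζ)))).mul
    (((m.mul m).mul ((k 1).sub (n.mul (k (ζ * conj ζ))))).mul
      ((((k 1).sub (i.mul (k (conj ζ)))).inv h₂).mul (((k 1).sub (s.mul (k ζ))).inv c₂)))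
  have h := (q.add r).sub t
  simp only [← ofReal_Γ1] at h
  have h' := h.congr_deriv (a' := dΓ1 w ζ) (by
    rw [dΓ1]
    simp only [div_eq_mul_inv, ← inv_pow]
    linear_combination ((conj w - conj ζ) * (1 - (1/4) * (w + ζ) * (conj w + conj ζ))
      * (1 - ζ * conj ζ) * (1 - w * conj ζ)⁻¹) * mul_inv_cancel₀ h₁) rfl
  exact h'.congr_deriv rfl h'.eq_conj

theorem hasWirtingerDerivAt_dΓ1 {w ζ : ℂ} (h₁ : w - ζ ≠ 0) (h₂ : 1 - w * conj ζ ≠ 0) :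
    ∃ a, HasWirtingerDerivAt (fun v => dΓ1 v ζ) a
      (((1 - normSq w) * (greenG w ζ + H1 w ζ) : ℝ) : ℂ) w := by
  have c₁ : conj w - conj ζ ≠ 0 := by simpa only [map_sub] using (map_ne_zero conj).2 h₁
  have c₂ : 1 - conj w * ζ ≠ 0 := by simpa using (map_ne_zero conj).2 h₂
  have k (c : ℂ) := HasWirtingerDerivAt.const c w
  have i := HasWirtingerDerivAt.id w
  have s := HasWirtingerDerivAt.star w
  have n := i.mul s
  have m := (k 1).sub n
  have x := ((k 1).sub (i.mul (k (conj ζ)))).inv h₂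
  have y := ((k 1).sub (s.mul (k ζ))).inv c₂
  have l := (k 1).sub (n.mul (k (ζ * conj ζ)))
  have e := s.sub (k (conj ζ))
  have q := (e.sub (((k (1/2)).mul i).mul ((s.mul s).sub (k (conj ζ * conj ζ))))).mul
    (HasWirtingerDerivAt.greenG h₁ h₂)
  have p := ((e.mul ((k 1).sub (((k (1/4)).mul (i.add (k ζ))).mul (s.add (k (conj ζ)))))).mul
    (k (1 - ζ * conj ζ))).mul x
  have r := (k ((1/8) * (1 - ζ * conj ζ))).mul
    ((m.mul ((((k 0).sub s).sub ((s.mul (k ζ)).mul (k (conj ζ)))).sub (k (2 * conj ζ)))).sub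
      (s.mul (((((k 7).sub n).sub (k (ζ * conj ζ))).sub (n.mul (k (ζ * conj ζ)))).sub
        ((k 2).mul ((i.mul (k (conj ζ))).add (s.mul (k ζ)))))))
  have t := (((k ((1/4) * ((1 - ζ * conj ζ) * (1 - ζ * conj ζ)))).mul x).mul y).mul
    ((((((m.mul m).mul l).mul (k (conj ζ))).mul x).sub
      ((((m.mul m).mul s).mul (k ζ)).mul (k (conj ζ)))).sub ((((k 2).mul s).mul m).mul l))
  refine ⟨_, HasWirtingerDerivAt.congr_deriv (((q.add p).add r).sub t) rfl ?_⟩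
  push_cast [ofReal_H1, ← mul_conj]
  generalize (_root_.greenG w ζ : ℂ) = g at *
  generalize conj w = w' at *
  generalize conj ζ = ζ' at *
  field_simp
  ring

/-- `Δ_z Γ₁(z,ζ) = (1-|z|²)(G(z,ζ) + H₁(z,ζ))` for `ζ` in the open unit disk and `z ≠ ζ`
in the closed unit disk. -/
theorem statement12 (ζ : ℂ) (hζ : ζ ∈ ball (0:ℂ) 1)
    (z : ℂ) (hz : z ∈ closedBall (0:ℂ) 1) (hne : z ≠ ζ) :
    lap (fun w => Γ1 w ζ) z = (1 - normSq z) * (greenG z ζ + H1 z ζ) := by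
  rw [mem_ball_zero_iff] at hζ
  rw [mem_closedBall_zero_iff] at hz
  have h₁ : z - ζ ≠ 0 := sub_ne_zero.2 hne
  have h₂ : 1 - z * conj ζ ≠ 0 := by
    rw [sub_ne_zero]
    intro h
    have hn : 1 = ‖z‖ * ‖ζ‖ := by simpa using congrArg norm h
    nlinarith [norm_nonneg z, norm_nonneg ζ]
  have o₁ : ∀ᶠ w in nhds z, w - ζ ≠ 0 :=
    (continuous_id.sub continuous_const).continuousAt.eventually_ne h₁
  have o₂ : ∀ᶠ w in nhds z, 1 - w * conj ζ ≠ 0 :=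
    (continuous_const.sub (continuous_id.mul continuous_const)).continuousAt.eventually_ne h₂
  obtain ⟨a, ha⟩ := hasWirtingerDerivAt_dΓ1 h₁ h₂
  rw [lap_eq_re ((o₁.and o₂).mono fun w hw => hasWirtingerDerivAt_Γ1 hw.1 hw.2) ha, ofReal_re]
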